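/- Assume r_j ≤ 1 for all outcomes j. There is an absolute constant A > 0 such that for every ε, δ ∈ (0,1), every ρ ≥ 0, and every N ≥ A·(1/ε²)·(m·log₂(m·n) + log(1/δ)), the following holds for every finitely supported probability distribution D on Θ_all: with probability at least 1 − δ over an i.i.d. sample (θ_1,…,θ_N) ∼ D^N, every contract t ∈ C_bounded satisfying (1/N)·Σ_{i≤N} u_p(θ_i, t) ≥ sup_{t'∈C_bounded} (1/N)·Σ_{i≤N} u_p(θ_i, t') − ρ also satisfies E_{θ∼D}[u_p(θ, t)] ≥ OPT(C_bounded, D) − ε − ρ. -/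

import Mathlib

open scoped BigOperators

/-- An agent type in the hidden-action principal-agent model with `n` actions and
`m` outcomes: a production function `f` (a distribution over outcomes for each action)
and a nonnegative cost vector `c` with `c 0 = 0`. -/
structure AgentType (n m : ℕ) where
  f : Fin n → Fin m → ℝ
  c : Fin n → ℝ
  f_nonneg : ∀ i j, 0 ≤ f i j
  f_sum : ∀ i, ∑ j, f i j = 1
  c_nonneg : ∀ i, 0 ≤ c i
  c_zero : ∀ i : Fin n, (i : ℕ) = 0 → c i = 0

/-- The agent's expected utility for action `i` under contract `t`. -/
def uA {n m : ℕ} (θ : AgentType n m) (t : Fin m → ℝ) (i : Fin n) : ℝ :=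
  (∑ j, θ.f i j * t j) - θ.c i

/-- The principal's expected utility when the agent takes action `i` under contract `t`,
with rewards `r`. -/
def uPa {n m : ℕ} (r : Fin m → ℝ) (θ : AgentType n m) (t : Fin m → ℝ) (i : Fin n) : ℝ :=
  ∑ j, θ.f i j * (r j - t j)

/-- The set of the agent's best-response actions to contract `t`. -/
def BestResp {n m : ℕ} (θ : AgentType n m) (t : Fin m → ℝ) : Set (Fin n) :=
  {i | ∀ i', uA θ t i' ≤ uA θ t i}

/-- The principal's utility under contract `t`: the agent best-responds, breaking ties
in favor of the principal. -/
noncomputable def uP {n m : ℕ} (r : Fin m → ℝ) (θ : AgentType n m) (t : Fin m → ℝ) : ℝ :=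
  sSup (uPa r θ t '' BestResp θ t)

/-- The class of linear contracts `α • r`, `α ∈ [0,1]`. -/
def Clinear {m : ℕ} (r : Fin m → ℝ) : Set (Fin m → ℝ) :=
  {t | ∃ α : ℝ, α ∈ Set.Icc (0:ℝ) 1 ∧ t = fun j => α * r j}

/-- The class of bounded contracts `[0,1]^m`. -/
def Cbounded (m : ℕ) : Set (Fin m → ℝ) := {t | ∀ j, t j ∈ Set.Icc (0:ℝ) 1}

/-- The class of unbounded contracts `ℝ_{≥0}^m`. -/
def Cunbounded (m : ℕ) : Set (Fin m → ℝ) := {t | ∀ j, 0 ≤ t j}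

/-- A finitely supported probability distribution. -/
structure FinDist (α : Type*) where
  p : α → ℝ
  nonneg : ∀ a, 0 ≤ p a
  finite_support : (Function.support p).Finite
  total : ∑ᶠ a, p a = 1

/-- Expectation of `g` under a finitely supported distribution `D`. -/
noncomputable def expect {α : Type*} (D : FinDist α) (g : α → ℝ) : ℝ :=
  ∑ᶠ a, D.p a * g a

/-- `OPT(C, D)`: the supremum over contracts in `C` of the principal's expected utility. -/
noncomputable def OPT {n m : ℕ} (C : Set (Fin m → ℝ)) (r : Fin m → ℝ)
    (D : FinDist (AgentType n m)) : ℝ :=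
  sSup ((fun t => expect D (fun θ => uP r θ t)) '' C)

/-- Pseudo-dimension shattering: `C` shatters some `k` types in `Θ`. -/
def Shatters {n m : ℕ} (r : Fin m → ℝ) (C : Set (Fin m → ℝ))
    (Θ : Set (AgentType n m)) (k : ℕ) : Prop :=
  ∃ θ : Fin k → AgentType n m, (∀ j, θ j ∈ Θ) ∧ ∃ τ : Fin k → ℝ,
    ∀ S : Finset (Fin k), ∃ t ∈ C,
      (∀ j, j ∈ S → τ j ≤ uP r (θ j) t) ∧ (∀ j, j ∉ S → uP r (θ j) t < τ j)

/-- `Cbar` is an `ε`-approximation of `C` (representation error at most `ε`). -/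
def IsApprox (n : ℕ) {m : ℕ} (r : Fin m → ℝ) (Cbar C : Set (Fin m → ℝ)) (ε : ℝ) : Prop :=
  ∀ D : FinDist (AgentType n m), OPT Cbar r D ≥ OPT C r D - ε

/-- Best responses breaking ties in favor of the principal. -/
def BestRespP {n m : ℕ} (r : Fin m → ℝ) (θ : AgentType n m) (t : Fin m → ℝ) : Set (Fin n) :=
  {i | i ∈ BestResp θ t ∧ ∀ i' ∈ BestResp θ t, uPa r θ t i' ≤ uPa r θ t i}

/-- Principal's expected reward under the linear contract `α • r`. -/
noncomputable def rP {n m : ℕ} (r : Fin m → ℝ) (θ : AgentType n m) (α : ℝ) : ℝ :=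
  sSup ((fun i => ∑ j, θ.f i j * r j) '' BestRespP r θ (fun j => α * r j))

/-- The set of critical values of an agent type for linear contracts. -/
def CritSet {n m : ℕ} (r : Fin m → ℝ) (θ : AgentType n m) : Set ℝ :=
  {α | α ∈ Set.Ioc (0:ℝ) 1 ∧ ∀ ε : ℝ, 0 < ε → ε ≤ α → rP r θ (α - ε) ≠ rP r θ α}

/-- Probability of the event `E` under `N` i.i.d. samples from `D`. -/
noncomputable def prodProb {α : Type*} (D : FinDist α) (N : ℕ) (E : Set (Fin N → α)) : ℝ :=
  ∑ᶠ s ∈ E, ∏ i, D.p (s i)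

/-- The class of `ε`-discrete linear contracts. -/
def Leps {m : ℕ} (r : Fin m → ℝ) (ε : ℝ) : Set (Fin m → ℝ) :=
  {t | ∃ α : ℝ, ((∃ k : ℕ, α = k * ε ∧ k * ε ≤ 1) ∨ α = 1) ∧ t = fun j => α * r j}

/-- `K` linear functionals on a real vector space of dimension at most `d` realize at most
`(2 * K + 1) ^ d` sign patterns. -/
theorem ncard_range_sign_le (K : ℕ) : ∀ (d : ℕ) (V : Type) [AddCommGroup V] [Module ℝ V]
    [FiniteDimensional ℝ V], Module.finrank ℝ V ≤ d → ∀ φ : Fin K → V →ₗ[ℝ] ℝ,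
    (Set.range fun v k => SignType.sign (φ k v)).ncard ≤ (2 * K + 1) ^ d := by
  induction K with
  | zero =>
    intro d V _ _ _ _ φ
    simpa using Set.ncard_le_one_of_subsingleton
      (Set.range fun (v : V) (k : Fin 0) => SignType.sign (φ k v))
  | succ K ih =>
    intro d V _ _ _ hd φ
    set ψ := φ (Fin.last K) with hψ
    set χ : Fin K → V →ₗ[ℝ] ℝ := fun k => φ k.castSucc with hχ
    have hsnoc : ∀ v, (fun k => SignType.sign (φ k v)) =
        Fin.snoc (α := fun _ => SignType) (fun k => SignType.sign (χ k v))
          (SignType.sign (ψ v)) := by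
      intro v
      funext k
      refine Fin.lastCases ?_ (fun k => ?_) k <;> simp [hψ, hχ]
    set R := Set.range fun v k => SignType.sign (χ k v) with hR
    by_cases h0 : ψ = 0
    · have hsub : (Set.range fun v k => SignType.sign (φ k v)) ⊆
          (fun p => Fin.snoc (α := fun _ => SignType) p 0) '' R := by
        rintro _ ⟨v, rfl⟩
        refine ⟨_, ⟨v, rfl⟩, ?_⟩
        simp [hsnoc, h0]
      calc _ ≤ _ := Set.ncard_le_ncard hsub (Set.toFinite _)
        _ ≤ R.ncard := Set.ncard_image_le (Set.toFinite _)
        _ ≤ (2 * K + 1) ^ d := ih d V hd χ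
        _ ≤ _ := Nat.pow_le_pow_left (by omega) _
    · set W := LinearMap.ker ψ with hW
      set Q := Set.range fun (w : W) k => SignType.sign ((χ k ∘ₗ W.subtype) w) with hQ
      have hrank : Module.finrank ℝ W + 1 = Module.finrank ℝ V := by
        have h1 := ψ.finrank_range_add_finrank_ker
        have h2 : LinearMap.range ψ = ⊤ := LinearMap.range_eq_top.2 (LinearMap.surjective h0)
        rw [h2, finrank_top, Module.finrank_self] at h1
        rw [hW, ← h1, add_comm]
      obtain ⟨e, rfl⟩ : ∃ e, d = e + 1 := ⟨d - 1, by omega⟩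
      have hmem : ∀ v w : V, (∀ k, SignType.sign (χ k v) = SignType.sign (χ k w)) →
          SignType.sign (ψ v) ≠ SignType.sign (ψ w) →
          (fun k => SignType.sign (χ k v)) ∈ Q := by
        intro v w hvw hne
        have hconv : ∀ a b : ℝ, 0 < a → 0 < b → ψ (a • v + b • w) = 0 →
            (fun k => SignType.sign (χ k v)) ∈ Q := by
          intro a b ha hb h
          refine ⟨⟨a • v + b • w, h⟩, ?_⟩
          funext k
          have := hvw k
          simp only [LinearMap.comp_apply, Submodule.subtype_apply, map_add, map_smul, smul_eq_mul]
          rcases lt_trichotomy (χ k v) 0 with h1 | h1 | h1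
          · rw [sign_neg h1] at this ⊢
            have h2 := sign_eq_neg_one_iff.1 this.symm
            exact sign_neg (by nlinarith [mul_neg_of_pos_of_neg ha h1, mul_neg_of_pos_of_neg hb h2])
          · rw [h1, sign_zero] at this ⊢
            have h2 := sign_eq_zero_iff.1 this.symm
            simp [h2]
          · rw [sign_pos h1] at this ⊢
            have h2 := sign_eq_one_iff.1 this.symm
            exact sign_pos (by positivity)
        rcases lt_trichotomy (ψ v) 0 with h1 | h1 | h1
        · rcases lt_trichotomy (ψ w) 0 with h2 | h2 | h2
          · simp [sign_neg h1, sign_neg h2] at hne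
          · exact ⟨⟨w, h2⟩, funext fun k => (hvw k).symm⟩
          · exact hconv (ψ w) (-ψ v) h2 (by linarith) (by simp; ring)
        · exact ⟨⟨v, h1⟩, rfl⟩
        · rcases lt_trichotomy (ψ w) 0 with h2 | h2 | h2
          · exact hconv (-ψ w) (ψ v) (by linarith) h1 (by simp; ring)
          · exact ⟨⟨w, h2⟩, funext fun k => (hvw k).symm⟩
          · simp [sign_pos h1, sign_pos h2] at hne
      classical
      let s : (Fin K → SignType) → SignType := fun p =>
        if p ∈ Q then 0 else
          if h : ∃ v, (fun k => SignType.sign (χ k v)) = p then SignType.sign (ψ h.choose) else 0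
      have hsub : (Set.range fun v k => SignType.sign (φ k v)) ⊆
          (fun p => Fin.snoc (α := fun _ => SignType) p (s p)) '' R ∪
          ((fun p => Fin.snoc (α := fun _ => SignType) p 1) '' Q ∪
          (fun p => Fin.snoc (α := fun _ => SignType) p (-1)) '' Q) := by
        rintro _ ⟨v, rfl⟩
        simp only [hsnoc]
        set p := fun k => SignType.sign (χ k v) with hp
        by_cases hpQ : p ∈ Q
        · rcases h : SignType.sign (ψ v) with _ | _ | _
          · exact Or.inl ⟨p, ⟨v, rfl⟩, by simp [s, hpQ]⟩
          · exact Or.inr (Or.inr ⟨p, hpQ, rfl⟩)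
          · exact Or.inr (Or.inl ⟨p, hpQ, rfl⟩)
        · refine Or.inl ⟨p, ⟨v, rfl⟩, ?_⟩
          have hex : ∃ v, (fun k => SignType.sign (χ k v)) = p := ⟨v, rfl⟩
          have : s p = SignType.sign (ψ v) := by
            simp only [s, hpQ, if_false, dif_pos hex]
            by_contra hne
            exact hpQ (hmem v hex.choose (fun k => (congrFun hex.choose_spec k).symm) (Ne.symm hne))
          simp only [this]
      have h1 := ih (e + 1) V hd χ
      have h2 := ih e W (by omega) (fun k => χ k ∘ₗ W.subtype)
      calc _ ≤ _ := Set.ncard_le_ncard hsub (Set.toFinite _)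
        _ ≤ _ := (Set.ncard_union_le _ _).trans (Nat.add_le_add_left (Set.ncard_union_le _ _) _)
        _ ≤ R.ncard + (Q.ncard + Q.ncard) := by
          gcongr <;> exact Set.ncard_image_le (Set.toFinite _)
        _ ≤ (2 * K + 1) ^ (e + 1) + ((2 * K + 1) ^ e + (2 * K + 1) ^ e) := by gcongr
        _ = (2 * K + 1) ^ e * (2 * (K + 1) + 1) := by ring
        _ ≤ (2 * (K + 1) + 1) ^ e * (2 * (K + 1) + 1) := by gcongr; omega
        _ = _ := by ring

/-- If distinct words of `P` differ in more than a `β` fraction of the coordinates, some `k`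
coordinates already tell all of them apart. -/
theorem exists_injOn_comp {Y : Type*} [DecidableEq Y] {N : ℕ} (hN : 0 < N) (k : ℕ)
    (P : Finset (Fin N → Y)) (β : ℝ)
    (hsep : ∀ p ∈ P, ∀ q ∈ P, p ≠ q → β * N < hammingDist p q)
    (hk : (P.card : ℝ) ^ 2 * (1 - β) ^ k < 1) :
    ∃ y : Fin k → Fin N, Set.InjOn (fun p : Fin N → Y => p ∘ y) P := by
  by_contra! hcon
  have hcover : (Finset.univ : Finset (Fin k → Fin N)) ⊆ P.offDiag.biUnion fun pq =>
      Fintype.piFinset fun _ => Finset.univ.filter fun i => pq.1 i = pq.2 i := by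
    intro y _
    have := hcon y
    simp only [Set.InjOn, not_forall] at this
    obtain ⟨p, hp, q, hq, hpq, hne⟩ := this
    simp only [Finset.mem_biUnion, Finset.mem_offDiag, Fintype.mem_piFinset, Finset.mem_filter,
      Finset.mem_univ, true_and]
    exact ⟨(p, q), ⟨hp, hq, hne⟩, fun j => congrFun hpq j⟩
  have hagree : ∀ pq ∈ P.offDiag,
      ((Finset.univ.filter fun i => pq.1 i = pq.2 i).card : ℝ) ≤ (1 - β) * N := by
    rintro ⟨p, q⟩ hpq
    obtain ⟨hp, hq, hne⟩ := Finset.mem_offDiag.1 hpq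
    have h1 := hsep p hp q hq hne
    have h2 := Finset.card_filter_add_card_filter_not (s := (Finset.univ : Finset (Fin N)))
      (fun i => p i = q i)
    have h3 : hammingDist p q = (Finset.univ.filter fun i => ¬ p i = q i).card := rfl
    have h4 : ((Finset.univ.filter fun i => p i = q i).card : ℝ) + hammingDist p q = N := by
      rw [h3]; exact_mod_cast h2.trans (by simp)
    simp only
    linarith
  have hcard := (Finset.card_le_card hcover).trans Finset.card_biUnion_le
  have hreal : (N : ℝ) ^ k ≤ (P.card : ℝ) ^ 2 * ((1 - β) ^ k * (N : ℝ) ^ k) := by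
    calc (N : ℝ) ^ k = ((Finset.univ : Finset (Fin k → Fin N)).card : ℝ) := by simp
      _ ≤ ∑ pq ∈ P.offDiag, (((Finset.univ.filter fun i => pq.1 i = pq.2 i).card : ℝ)) ^ k := by
        refine le_trans (Nat.cast_le.2 hcard) (le_of_eq ?_)
        push_cast
        simp
      _ ≤ ∑ pq ∈ P.offDiag, ((1 - β) * N) ^ k :=
        Finset.sum_le_sum fun pq hpq => pow_le_pow_left₀ (by positivity) (hagree pq hpq) k
      _ = (P.offDiag.card : ℝ) * ((1 - β) ^ k * (N : ℝ) ^ k) := by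
        rw [Finset.sum_const, nsmul_eq_mul, mul_pow]
      _ ≤ _ := by
        rcases P.offDiag.eq_empty_or_nonempty with h | ⟨pq, hpq⟩
        · have : (Finset.univ : Finset (Fin k → Fin N)).card ≤ 0 := by simpa [h] using hcard
          have hpos : 0 < N ^ k := pow_pos hN k
          simp at this
          omega
        · have hnn : 0 ≤ (1 - β) * N := le_trans (by positivity) (hagree pq hpq)
          have hnn' : 0 ≤ ((1 - β) ^ k * (N : ℝ) ^ k) := by
            rw [← mul_pow]; exact pow_nonneg hnn k
          refine mul_le_mul_of_nonneg_right ?_ hnn'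
          have : P.offDiag.card ≤ P.card ^ 2 := by
            rw [Finset.offDiag_card, sq]; exact Nat.sub_le _ _
          exact_mod_cast this
  have hpos : (0 : ℝ) < (N : ℝ) ^ k := by positivity
  nlinarith

/-- A family of words that cannot be separated by more than `B` words admits a `B`-element net. -/
theorem exists_hamming_net {Y : Type*} [DecidableEq Y] {N : ℕ} (Q : Finset (Fin N → Y))
    (β : ℝ) (hβ : 0 ≤ β) (B : ℕ)
    (hpack : ∀ P ⊆ Q, (∀ p ∈ P, ∀ q ∈ P, p ≠ q → β * N < hammingDist p q) → P.card ≤ B) :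
    ∃ P ⊆ Q, P.card ≤ B ∧ ∀ q ∈ Q, ∃ p ∈ P, (hammingDist q p : ℝ) ≤ β * N := by
  classical
  let S := Q.powerset.filter fun P => ∀ p ∈ P, ∀ q ∈ P, p ≠ q → β * N < hammingDist p q
  obtain ⟨P, hP⟩ := S.exists_maximal ⟨∅, by simp [S]⟩
  obtain ⟨hPQ, hsep⟩ : P ⊆ Q ∧ ∀ p ∈ P, ∀ q ∈ P, p ≠ q → β * N < hammingDist p q := by
    simpa [S] using hP.1
  refine ⟨P, hPQ, hpack P hPQ hsep, fun q hq => ?_⟩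
  by_contra! hcon
  have hqP : q ∉ P := fun h => by
    have := hcon q h
    rw [hammingDist_self] at this
    have h0 : 0 ≤ β * N := by positivity
    simp at this
    linarith
  have hins : insert q P ∈ S := by
    simp only [S, Finset.mem_filter, Finset.mem_powerset]
    refine ⟨Finset.insert_subset hq hPQ, fun a ha b hb hab => ?_⟩
    rcases Finset.mem_insert.1 ha with rfl | haP <;>
      rcases Finset.mem_insert.1 hb with rfl | hbP
    · exact absurd rfl hab
    · exact hcon b hbP
    · rw [hammingDist_comm]; exact hcon a haP
    · exact hsep a haP b hbP hab
  exact hqP (hP.2 hins (Finset.subset_insert q P) (Finset.mem_insert_self q P))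

/-- The sign `±1` encoded by a Boolean. -/
def boolSign (b : Bool) : ℝ := if b then 1 else -1

theorem sum_exp_boolSign_le {N : ℕ} (x : Fin N → ℝ) (l V : ℝ) (hV : ∑ i, x i ^ 2 ≤ V) :
    ∑ σ : Fin N → Bool, Real.exp (l * ∑ i, boolSign (σ i) * x i) ≤
      2 ^ N * Real.exp (l ^ 2 * V / 2) := by
  have h1 : ∑ σ : Fin N → Bool, Real.exp (l * ∑ i, boolSign (σ i) * x i) =
      ∏ i, ∑ b : Bool, Real.exp (l * (boolSign b * x i)) := by
    rw [Finset.prod_univ_sum]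
    simp only [Finset.mul_sum, Real.exp_sum, Fintype.piFinset_univ]
  rw [h1]
  calc _ ≤ ∏ i, (2 * Real.exp ((l * x i) ^ 2 / 2)) := by
        refine Finset.prod_le_prod (fun i _ => Finset.sum_nonneg fun b _ => (Real.exp_pos _).le)
          fun i _ => ?_
        have := Real.cosh_le_exp_half_sq (l * x i)
        rw [Real.cosh_eq] at this
        simp only [Fintype.sum_bool, boolSign]
        norm_num
        linarith
    _ = 2 ^ N * Real.exp (l ^ 2 * (∑ i, x i ^ 2) / 2) := by
        rw [Finset.prod_mul_distrib, ← Real.exp_sum]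
        simp only [Finset.prod_const, Finset.card_univ, Fintype.card_fin, mul_pow, Finset.mul_sum,
          Finset.sum_div]
    _ ≤ _ := by gcongr

/-- Hoeffding's inequality for Rademacher sums, in counting form. -/
theorem card_boolSign_sum_gt_le {N : ℕ} (x : Fin N → ℝ) (u V : ℝ) (hu : 0 ≤ u) (hV0 : 0 < V)
    (hV : ∑ i, x i ^ 2 ≤ V) :
    ((Finset.univ.filter fun σ : Fin N → Bool => u < |∑ i, boolSign (σ i) * x i|).card : ℝ) ≤
      2 ^ N * (2 * Real.exp (-(u ^ 2 / (2 * V)))) := by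
  set l := u / V with hl
  have hl0 : 0 ≤ l := by positivity
  have h1 := sum_exp_boolSign_le x l V hV
  have h2 := sum_exp_boolSign_le x (-l) V hV
  have key : ((Finset.univ.filter fun σ : Fin N → Bool =>
      u < |∑ i, boolSign (σ i) * x i|).card : ℝ) * Real.exp (l * u) ≤
      2 ^ N * Real.exp (l ^ 2 * V / 2) + 2 ^ N * Real.exp ((-l) ^ 2 * V / 2) := by
    refine le_trans ?_ (add_le_add h1 h2)
    rw [← Finset.sum_add_distrib, ← nsmul_eq_mul, ← Finset.sum_const]
    refine le_trans (Finset.sum_le_sum fun σ hσ => ?_)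
      (Finset.sum_le_sum_of_subset_of_nonneg (Finset.filter_subset _ _) fun σ _ _ => by positivity)
    have hσ' := (Finset.mem_filter.1 hσ).2
    rcases lt_abs.1 hσ' with h | h
    · have : Real.exp (l * u) ≤ Real.exp (l * ∑ i, boolSign (σ i) * x i) := by gcongr
      linarith [Real.exp_pos (-l * ∑ i, boolSign (σ i) * x i)]
    · have : Real.exp (l * u) ≤ Real.exp (-l * ∑ i, boolSign (σ i) * x i) := by
        refine Real.exp_le_exp.2 ?_
        nlinarith
      linarith [Real.exp_pos (l * ∑ i, boolSign (σ i) * x i)]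
  have he : Real.exp (-(u ^ 2 / (2 * V))) = Real.exp (l ^ 2 * V / 2) / Real.exp (l * u) := by
    rw [← Real.exp_sub]
    congr 1
    rw [hl]
    field_simp
    ring
  rw [he]
  rw [neg_sq] at key
  have : 2 ^ N * (2 * (Real.exp (l ^ 2 * V / 2) / Real.exp (l * u))) =
      (2 ^ N * Real.exp (l ^ 2 * V / 2) + 2 ^ N * Real.exp (l ^ 2 * V / 2)) / Real.exp (l * u) := by
    ring
  rw [this, le_div_iff₀ (Real.exp_pos _)]
  exact key

open Classical in
/-- Chaining bound for Rademacher sums over a class with a label at each scale `1 / 4 ^ k`. -/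
theorem card_rademacher_gt_le {T : Type*} {N : ℕ} (f : T → Fin N → ℝ)
    (hf : ∀ t i, |f t i| ≤ 1) (H : ℝ) (hH : 0 ≤ H)
    (hcov : ∀ k : ℕ, ∃ M : ℕ, (M : ℝ) ≤ Real.exp (H * (k + 1)) ∧ ∃ label : T → Fin M,
      ∀ t t', label t = label t' → ∑ i, (f t i - f t' i) ^ 2 ≤ (N : ℝ) / 16 ^ k)
    (hN : 0 < N) (b η : ℝ) (hb : 0 < b)
    (hη : ∀ K : ℕ, ∑ k ∈ Finset.range K,
      Real.exp (2 * H * (k + 1)) * (2 * Real.exp (-(N * b ^ 2 * 4 ^ k / 2048))) ≤ η) :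
    ((Finset.univ.filter fun σ : Fin N → Bool =>
      ∃ t, b * N < |∑ i, boolSign (σ i) * f t i|).card : ℝ) ≤ 2 ^ N * η := by
  have hNR : (0 : ℝ) < N := by exact_mod_cast hN
  choose M hM label hlabel using hcov
  obtain ⟨K, hK⟩ : ∃ K : ℕ, (1 / 4 : ℝ) ^ K < b / 2 :=
    exists_pow_lt_of_lt_one (by positivity) (by norm_num)
  let rep : ∀ k, Fin (M k) → Fin N → ℝ := fun k l =>
    if h : ∃ t, label k t = l then f h.choose else 0
  have hrep : ∀ k t, ∑ i, (f t i - rep k (label k t) i) ^ 2 ≤ (N : ℝ) / 16 ^ k := by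
    intro k t
    have hex : ∃ t', label k t' = label k t := ⟨t, rfl⟩
    simp only [rep, dif_pos hex]
    exact hlabel k t _ hex.choose_spec.symm
  -- the links of the chain
  let link : ∀ k, T → Fin N → ℝ := fun k t i =>
    match k with
    | 0 => rep 0 (label 0 t) i
    | k + 1 => rep (k + 1) (label (k + 1) t) i - rep k (label k t) i
  have hlink_sum : ∀ K t i, ∑ k ∈ Finset.range (K + 1), link k t i = rep K (label K t) i := by
    intro K t i
    induction K with
    | zero => simp [link]
    | succ K ih => rw [Finset.sum_range_succ, ih]; simp [link]
  have hlink_sq : ∀ k t, ∑ i, link k t i ^ 2 ≤ 64 * N / 16 ^ k := by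
    intro k t
    cases k with
    | zero =>
      simp only [link, pow_zero, div_one]
      have hex : ∃ t', label 0 t' = label 0 t := ⟨t, rfl⟩
      simp only [rep, dif_pos hex]
      calc _ ≤ ∑ i : Fin N, (1 : ℝ) := Finset.sum_le_sum fun i _ => by
            rw [← sq_abs]; exact pow_le_one₀ (abs_nonneg _) (hf _ i)
        _ ≤ _ := by simp; linarith
    | succ k =>
      have h1 := hrep k t
      have h2 := hrep (k + 1) t
      calc ∑ i, link (k + 1) t i ^ 2
          ≤ ∑ i, (2 * (f t i - rep k (label k t) i) ^ 2 +
              2 * (f t i - rep (k + 1) (label (k + 1) t) i) ^ 2) := by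
            refine Finset.sum_le_sum fun i _ => ?_
            simp only [link]
            nlinarith [sq_nonneg ((f t i - rep k (label k t) i) +
              (f t i - rep (k + 1) (label (k + 1) t) i))]
        _ = 2 * ∑ i, (f t i - rep k (label k t) i) ^ 2 +
              2 * ∑ i, (f t i - rep (k + 1) (label (k + 1) t) i) ^ 2 := by
            rw [Finset.sum_add_distrib, Finset.mul_sum, Finset.mul_sum]
        _ ≤ 2 * (N / 16 ^ k) + 2 * (N / 16 ^ (k + 1)) := by gcongr
        _ ≤ _ := by
            rw [pow_succ]
            have : (0 : ℝ) < N / 16 ^ k := by positivity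
            have e1 : (N : ℝ) / (16 ^ k * 16) = N / 16 ^ k / 16 := by rw [div_div]
            have e2 : 64 * (N : ℝ) / (16 ^ k * 16) = 4 * (N / 16 ^ k) := by field_simp; norm_num
            rw [e1, e2]
            linarith
  have hlink_fin : ∀ k, ∃ L : Finset (Fin N → ℝ), (∀ v, v ∈ L ↔ ∃ t, link k t = v) ∧
      (L.card : ℝ) ≤ Real.exp (2 * H * (k + 1)) := by
    intro k
    cases k with
    | zero =>
      have hsub : Set.range (link 0) ⊆ Set.range (rep 0) := by
        rintro _ ⟨t, rfl⟩; exact ⟨label 0 t, rfl⟩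
      have hfin := (Set.finite_range (rep 0)).subset hsub
      refine ⟨hfin.toFinset, by simp, ?_⟩
      rw [← Set.ncard_eq_toFinset_card _ hfin]
      have hle : (Set.range (link 0)).ncard ≤ M 0 := by
        refine (Set.ncard_le_ncard hsub (Set.finite_range _)).trans ?_
        rw [← Set.image_univ]
        exact (Set.ncard_image_le Set.finite_univ).trans (by simp [Set.ncard_univ])
      calc ((Set.range (link 0)).ncard : ℝ) ≤ M 0 := by exact_mod_cast hle
        _ ≤ _ := hM 0
        _ ≤ _ := by simp only [Nat.cast_zero]; gcongr; linarith
    | succ k =>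
      let g : Fin (M (k + 1)) × Fin (M k) → Fin N → ℝ := fun q i => rep (k + 1) q.1 i - rep k q.2 i
      have hsub : Set.range (link (k + 1)) ⊆ Set.range g := by
        rintro _ ⟨t, rfl⟩; exact ⟨(label (k + 1) t, label k t), rfl⟩
      have hfin := (Set.finite_range g).subset hsub
      refine ⟨hfin.toFinset, by simp, ?_⟩
      rw [← Set.ncard_eq_toFinset_card _ hfin]
      have hle : (Set.range (link (k + 1))).ncard ≤ M (k + 1) * M k := by
        refine (Set.ncard_le_ncard hsub (Set.finite_range _)).trans ?_
        rw [← Set.image_univ]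
        exact (Set.ncard_image_le Set.finite_univ).trans (by simp [Set.ncard_univ])
      calc ((Set.range (link (k + 1))).ncard : ℝ) ≤ M (k + 1) * M k := by exact_mod_cast hle
        _ ≤ Real.exp (H * ((k + 1 : ℕ) + 1)) * Real.exp (H * (k + 1)) := by
          gcongr
          · exact hM (k + 1)
          · exact hM k
        _ ≤ _ := by
          rw [← Real.exp_add]
          gcongr
          push_cast
          nlinarith
  choose L hLmem hLcard using hlink_fin
  have htel : ∀ (σ : Fin N → Bool) t, |∑ i, boolSign (σ i) * f t i| ≤
      (∑ k ∈ Finset.range (K + 1), |∑ i, boolSign (σ i) * link k t i|) + b / 2 * N := by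
    intro σ t
    have e : ∑ i, boolSign (σ i) * f t i =
        (∑ k ∈ Finset.range (K + 1), ∑ i, boolSign (σ i) * link k t i) +
          ∑ i, boolSign (σ i) * (f t i - rep K (label K t) i) := by
      rw [Finset.sum_comm, ← Finset.sum_add_distrib]
      refine Finset.sum_congr rfl fun i _ => ?_
      rw [← Finset.mul_sum, hlink_sum]
      ring
    rw [e]
    refine (abs_add_le _ _).trans (add_le_add (Finset.abs_sum_le_sum_abs _ _) ?_)
    refine Real.abs_le_sqrt (y := ((1 / 4 : ℝ) ^ K * N) ^ 2) ?_ |>.trans ?_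
    · have hcs := Finset.sum_mul_sq_le_sq_mul_sq Finset.univ (fun i => boolSign (σ i))
        (fun i => f t i - rep K (label K t) i)
      have h1 : ∑ i, boolSign (σ i) ^ 2 = N := by
        have : ∀ b, boolSign b ^ 2 = 1 := by intro b; cases b <;> simp [boolSign]
        simp [this]
      rw [h1] at hcs
      refine hcs.trans ?_
      have h2 := hrep K t
      calc _ ≤ (N : ℝ) * (N / 16 ^ K) := by gcongr
        _ = _ := by
          rw [mul_pow, ← pow_mul, mul_comm K 2, pow_mul, one_div, inv_pow, inv_pow]
          norm_num
          ring
    · rw [Real.sqrt_sq (by positivity)]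
      gcongr
  have hsubset : (Finset.univ.filter fun σ : Fin N → Bool =>
      ∃ t, b * N < |∑ i, boolSign (σ i) * f t i|) ⊆
      (Finset.range (K + 1)).biUnion fun k => (L k).biUnion fun v =>
        Finset.univ.filter fun σ : Fin N → Bool =>
          b / 4 * (1 / 2) ^ k * N < |∑ i, boolSign (σ i) * v i| := by
    intro σ hσ
    obtain ⟨t, ht⟩ := (Finset.mem_filter.1 hσ).2
    by_contra hcon
    simp only [Finset.mem_biUnion, Finset.mem_filter, Finset.mem_univ, true_and, not_exists,
      not_and, not_lt] at hcon
    have hle : ∑ k ∈ Finset.range (K + 1), |∑ i, boolSign (σ i) * link k t i| ≤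
        ∑ k ∈ Finset.range (K + 1), b / 4 * (1 / 2) ^ k * N :=
      Finset.sum_le_sum fun k hk => hcon k hk _ ((hLmem k _).2 ⟨t, rfl⟩)
    have hgeo : ∑ k ∈ Finset.range (K + 1), b / 4 * (1 / 2) ^ k * N ≤ b / 2 * N := by
      rw [← Finset.sum_mul, ← Finset.mul_sum]
      have := sum_geometric_two_le (K + 1)
      gcongr
      calc b / 4 * _ ≤ b / 4 * 2 := by gcongr
        _ = b / 2 := by ring
    have := htel σ t
    linarith
  have hcard := (Finset.card_le_card hsubset).trans
    (Finset.card_biUnion_le.trans (Finset.sum_le_sum fun k _ => Finset.card_biUnion_le))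
  refine le_trans (Nat.cast_le.2 hcard) ?_
  push_cast
  refine le_trans ?_ (mul_le_mul_of_nonneg_left (hη (K + 1)) (by positivity))
  rw [Finset.mul_sum]
  refine Finset.sum_le_sum fun k _ => ?_
  calc _ ≤ ∑ v ∈ L k, 2 ^ N * (2 * Real.exp (-(N * b ^ 2 * 4 ^ k / 2048))) := by
        refine Finset.sum_le_sum fun v hv => ?_
        obtain ⟨t, rfl⟩ := (hLmem k v).1 hv
        refine (card_boolSign_sum_gt_le (link k t) _ (64 * N / 16 ^ k) (by positivity)
          (by positivity) (hlink_sq k t)).trans (le_of_eq ?_)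
        congr 4
        have e : (16 : ℝ) ^ k = 4 ^ k * 4 ^ k := by rw [← mul_pow]; norm_num
        have e2 : ((1 / 2 : ℝ) ^ k) ^ 2 = 1 / 4 ^ k := by
          rw [← pow_mul, mul_comm, pow_mul, ← one_div_pow]; norm_num
        rw [mul_pow, mul_pow, e2, e]
        field_simp
        norm_num
    _ = (L k).card * (2 ^ N * (2 * Real.exp (-(N * b ^ 2 * 4 ^ k / 2048)))) := by
        rw [Finset.sum_const, nsmul_eq_mul]
    _ ≤ Real.exp (2 * H * (k + 1)) * (2 ^ N * (2 * Real.exp (-(N * b ^ 2 * 4 ^ k / 2048)))) := by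
        gcongr
        exact hLcard k
    _ = _ := by ring

open Classical in
/-- Probability of `P` under `N` independent draws with weights `p` on a finite type. -/
noncomputable def iidProb {Ω : Type*} [Fintype Ω] (p : Ω → ℝ) (N : ℕ)
    (P : (Fin N → Ω) → Prop) : ℝ :=
  ∑ s : Fin N → Ω, (∏ i, p (s i)) * if P s then 1 else 0

theorem sum_prod_eq_one {Ω : Type*} [Fintype Ω] (p : Ω → ℝ) (h1 : ∑ ω, p ω = 1) (N : ℕ) :
    ∑ s : Fin N → Ω, ∏ i, p (s i) = 1 := by
  classical
  have := Finset.prod_univ_sum (fun _ : Fin N => (Finset.univ : Finset Ω)) (fun _ ω => p ω)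
  rw [Fintype.piFinset_univ] at this
  rw [← this]
  simp [h1]

theorem iidProb_add_iidProb_not {Ω : Type*} [Fintype Ω] (p : Ω → ℝ) (h1 : ∑ ω, p ω = 1) (N : ℕ)
    (P : (Fin N → Ω) → Prop) : iidProb p N P + iidProb p N (fun s => ¬ P s) = 1 := by
  rw [← sum_prod_eq_one p h1 N, iidProb, iidProb, ← Finset.sum_add_distrib]
  refine Finset.sum_congr rfl fun s _ => ?_
  by_cases h : P s <;> simp [h]

theorem iidProb_mono {Ω : Type*} [Fintype Ω] {p : Ω → ℝ} (h0 : ∀ ω, 0 ≤ p ω) {N : ℕ}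
    {P Q : (Fin N → Ω) → Prop} (h : ∀ s, P s → Q s) : iidProb p N P ≤ iidProb p N Q := by
  refine Finset.sum_le_sum fun s _ => mul_le_mul_of_nonneg_left ?_
    (Finset.prod_nonneg fun i _ => h0 _)
  by_cases hP : P s
  · simp [hP, h s hP]
  · simp only [hP, if_false]; split_ifs <;> norm_num

theorem iidProb_or_le {Ω : Type*} [Fintype Ω] {p : Ω → ℝ} (h0 : ∀ ω, 0 ≤ p ω) {N : ℕ}
    (P Q : (Fin N → Ω) → Prop) :
    iidProb p N (fun s => P s ∨ Q s) ≤ iidProb p N P + iidProb p N Q := by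
  rw [iidProb, iidProb, iidProb, ← Finset.sum_add_distrib]
  refine Finset.sum_le_sum fun s _ => ?_
  rw [← mul_add]
  refine mul_le_mul_of_nonneg_left ?_ (Finset.prod_nonneg fun i _ => h0 _)
  by_cases hP : P s <;> by_cases hQ : Q s <;> simp [hP, hQ]

/-- One-sided Hoeffding-type tail bound for a centred bounded variable. -/
theorem iidProb_sum_gt_le {Ω : Type*} [Fintype Ω] {p : Ω → ℝ} (h0 : ∀ ω, 0 ≤ p ω)
    (h1 : ∑ ω, p ω = 1) (N : ℕ) (g : Ω → ℝ) (hg : ∀ ω, |g ω| ≤ 2) (hmean : ∑ ω, p ω * g ω = 0)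
    (a : ℝ) (ha0 : 0 ≤ a) (ha : a ≤ 1) :
    iidProb p N (fun s => a / 2 * N < ∑ i, g (s i)) ≤ Real.exp (-(N * a ^ 2 / 64)) := by
  classical
  set l := a / 16 with hl
  have hmgf : ∑ ω, p ω * Real.exp (l * g ω) ≤ Real.exp (4 * l ^ 2) := by
    have hpt : ∀ ω, Real.exp (l * g ω) ≤ 1 + l * g ω + 4 * l ^ 2 := by
      intro ω
      have hb : |l * g ω| ≤ 1 := by
        rw [abs_mul, abs_of_nonneg (by positivity : 0 ≤ l)]
        nlinarith [hg ω, abs_nonneg (g ω)]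
      have h2 := (abs_le.1 (Real.abs_exp_sub_one_sub_id_le hb)).2
      have h3 : g ω ^ 2 ≤ 4 := by
        rw [← sq_abs]; nlinarith [hg ω, abs_nonneg (g ω)]
      nlinarith [sq_nonneg l]
    calc _ ≤ ∑ ω, p ω * (1 + l * g ω + 4 * l ^ 2) :=
          Finset.sum_le_sum fun ω _ => mul_le_mul_of_nonneg_left (hpt ω) (h0 ω)
      _ = ∑ ω, p ω + l * ∑ ω, p ω * g ω + 4 * l ^ 2 * ∑ ω, p ω := by
          rw [Finset.mul_sum, Finset.mul_sum, ← Finset.sum_add_distrib, ← Finset.sum_add_distrib]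
          exact Finset.sum_congr rfl fun ω _ => by ring
      _ = 4 * l ^ 2 + 1 := by rw [h1, hmean]; ring
      _ ≤ _ := Real.add_one_le_exp _
  have hprod : ∑ s : Fin N → Ω, (∏ i, p (s i)) * Real.exp (l * ∑ i, g (s i)) =
      (∑ ω, p ω * Real.exp (l * g ω)) ^ N := by
    have := Finset.prod_univ_sum (fun _ : Fin N => (Finset.univ : Finset Ω))
      (fun _ ω => p ω * Real.exp (l * g ω))
    rw [Fintype.piFinset_univ] at this
    simp only [Finset.prod_const, Finset.card_univ, Fintype.card_fin] at this
    rw [this]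
    refine Finset.sum_congr rfl fun s _ => ?_
    rw [Finset.prod_mul_distrib, Finset.mul_sum, Real.exp_sum]
  have hmarkov : iidProb p N (fun s => a / 2 * N < ∑ i, g (s i)) * Real.exp (l * (a / 2 * N)) ≤
      (∑ ω, p ω * Real.exp (l * g ω)) ^ N := by
    rw [← hprod, iidProb, Finset.sum_mul]
    refine Finset.sum_le_sum fun s _ => ?_
    rw [mul_assoc]
    refine mul_le_mul_of_nonneg_left ?_ (Finset.prod_nonneg fun i _ => h0 _)
    split_ifs with h
    · rw [one_mul]; gcongr
    · rw [zero_mul]; positivity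
  have h2 : (∑ ω, p ω * Real.exp (l * g ω)) ^ N ≤ Real.exp (N * (4 * l ^ 2)) := by
    rw [Real.exp_nat_mul]
    exact pow_le_pow_left₀ (Finset.sum_nonneg fun ω _ => mul_nonneg (h0 ω) (Real.exp_pos _).le)
      hmgf N
  have h3 : Real.exp (-(N * a ^ 2 / 64)) =
      Real.exp (N * (4 * l ^ 2)) / Real.exp (l * (a / 2 * N)) := by
    rw [← Real.exp_sub, hl]; congr 1; ring
  rw [h3, le_div_iff₀ (Real.exp_pos _)]
  exact hmarkov.trans h2

/-- Exchange the coordinates of two samples where `σ` is false. -/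
def sampleSwap {Ω : Type*} {N : ℕ} (σ : Fin N → Bool) :
    (Fin N → Ω) × (Fin N → Ω) ≃ (Fin N → Ω) × (Fin N → Ω) where
  toFun q := (fun i => if σ i then q.1 i else q.2 i, fun i => if σ i then q.2 i else q.1 i)
  invFun q := (fun i => if σ i then q.1 i else q.2 i, fun i => if σ i then q.2 i else q.1 i)
  left_inv q := by ext i <;> by_cases h : σ i <;> simp [h]
  right_inv q := by ext i <;> by_cases h : σ i <;> simp [h]

open Classical in
/-- Symmetrization: a conditional Rademacher bound on every sample yields uniform convergence. -/
theorem iidProb_exists_deviation_le {Ω T : Type*} [Fintype Ω] {p : Ω → ℝ} (h0 : ∀ ω, 0 ≤ p ω)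
    (h1 : ∑ ω, p ω = 1) {N : ℕ} (f : T → Ω → ℝ) (hf : ∀ t ω, |f t ω| ≤ 1)
    {a η : ℝ} (ha0 : 0 ≤ a) (ha : a ≤ 1) (hexp : Real.exp (-(N * a ^ 2 / 64)) ≤ 1 / 4)
    (hrad : ∀ s : Fin N → Ω, ((Finset.univ.filter fun σ : Fin N → Bool =>
      ∃ t, a / 4 * N < |∑ i, boolSign (σ i) * f t (s i)|).card : ℝ) ≤ 2 ^ N * η) :
    iidProb p N (fun s => ∃ t, a * N < |∑ i, f t (s i) - N * ∑ ω, p ω * f t ω|) ≤ 4 * η := by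
  set w : (Fin N → Ω) → ℝ := fun s => ∏ i, p (s i) with hw
  have hw0 : ∀ s, 0 ≤ w s := fun s => Finset.prod_nonneg fun i _ => h0 _
  have hw1 : ∑ s, w s = 1 := sum_prod_eq_one p h1 N
  set Hd : (Fin N → Ω) → (Fin N → Ω) → Prop := fun s s' =>
    ∃ t, a / 2 * N < |∑ i, f t (s i) - ∑ i, f t (s' i)| with hHd
  set R : (Fin N → Ω) → (Fin N → Bool) → Prop := fun s σ =>
    ∃ t, a / 4 * N < |∑ i, boolSign (σ i) * f t (s i)| with hR
  have hmean_le : ∀ t, |∑ ω, p ω * f t ω| ≤ 1 := by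
    intro t
    calc _ ≤ ∑ ω, |p ω * f t ω| := Finset.abs_sum_le_sum_abs _ _
      _ ≤ ∑ ω, p ω := Finset.sum_le_sum fun ω _ => by
          rw [abs_mul, abs_of_nonneg (h0 ω)]
          exact mul_le_of_le_one_right (h0 ω) (hf t ω)
      _ = 1 := h1
  -- a fixed contract is well estimated by the ghost sample with probability at least one half
  have hghost : ∀ t, 1 / 2 ≤ iidProb p N
      (fun s' => |∑ i, f t (s' i) - N * ∑ ω, p ω * f t ω| ≤ a / 2 * N) := by
    intro t
    set μ := ∑ ω, p ω * f t ω with hμ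
    have hb : ∀ ω, |f t ω - μ| ≤ 2 := fun ω => by
      have := abs_sub (f t ω) μ
      linarith [hf t ω, hmean_le t]
    have hm : ∑ ω, p ω * (f t ω - μ) = 0 := by
      simp only [mul_sub, Finset.sum_sub_distrib, ← Finset.sum_mul, h1]
      rw [← hμ]; ring
    have hup := iidProb_sum_gt_le h0 h1 N (fun ω => f t ω - μ) hb hm a ha0 ha
    have hlo := iidProb_sum_gt_le h0 h1 N (fun ω => μ - f t ω)
      (fun ω => by rw [abs_sub_comm]; exact hb ω)
      (by rw [← neg_zero, ← hm, ← Finset.sum_neg_distrib]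
          exact Finset.sum_congr rfl fun ω _ => by ring) a ha0 ha
    have hcompl := iidProb_add_iidProb_not p h1 N
      (fun s' => |∑ i, f t (s' i) - N * μ| ≤ a / 2 * N)
    have hbad : iidProb p N (fun s' => ¬ |∑ i, f t (s' i) - N * μ| ≤ a / 2 * N) ≤
        iidProb p N (fun s => a / 2 * N < ∑ i, (f t (s i) - μ)) +
        iidProb p N (fun s => a / 2 * N < ∑ i, (μ - f t (s i))) := by
      refine le_trans (iidProb_mono h0 fun s hs => ?_) (iidProb_or_le h0 _ _)
      rw [not_le, lt_abs] at hs
      simpa [Finset.sum_sub_distrib] using hs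
    linarith
  have hstep1 : iidProb p N
      (fun s => ∃ t, a * N < |∑ i, f t (s i) - N * ∑ ω, p ω * f t ω|) ≤
      2 * ∑ s, ∑ s', w s * w s' * if Hd s s' then 1 else 0 := by
    rw [iidProb, Finset.mul_sum]
    refine Finset.sum_le_sum fun s _ => ?_
    split_ifs with hs
    · obtain ⟨t, ht⟩ := hs
      have hle : iidProb p N (fun s' => |∑ i, f t (s' i) - N * ∑ ω, p ω * f t ω| ≤ a / 2 * N) ≤
          ∑ s', w s' * if Hd s s' then 1 else 0 := by
        refine iidProb_mono h0 fun s' hs' => ⟨t, ?_⟩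
        have := abs_sub_le (∑ i, f t (s i)) (∑ i, f t (s' i)) (N * ∑ ω, p ω * f t ω)
        linarith
      have h2 := hghost t
      simp only [mul_assoc, ← Finset.mul_sum]
      have := mul_le_mul_of_nonneg_left (h2.trans hle) (hw0 s)
      simp only [hw] at this ⊢
      linarith
    · rw [mul_zero]
      refine mul_nonneg zero_le_two (Finset.sum_nonneg fun s' _ => ?_)
      have := mul_nonneg (hw0 s) (hw0 s')
      split_ifs <;> simp [this]
  have hswap : ∀ σ : Fin N → Bool,
      ∑ s, ∑ s', w s * w s' * (if Hd s s' then (1 : ℝ) else 0) ≤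
      ∑ s, ∑ s', w s * w s' * ((if R s σ then 1 else 0) + if R s' σ then 1 else 0) := by
    intro σ
    rw [← Fintype.sum_prod_type', ← Fintype.sum_prod_type', ← (sampleSwap σ).sum_comp]
    refine Finset.sum_le_sum fun q _ => ?_
    have hww : w (sampleSwap σ q).1 * w (sampleSwap σ q).2 = w q.1 * w q.2 := by
      simp only [hw, sampleSwap, Equiv.coe_fn_mk, ← Finset.prod_mul_distrib]
      refine Finset.prod_congr rfl fun i _ => ?_
      by_cases h : σ i
      · simp [h]
      · simp [h, mul_comm]
    rw [hww]
    refine mul_le_mul_of_nonneg_left ?_ (mul_nonneg (hw0 _) (hw0 _))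
    have himp : Hd (sampleSwap σ q).1 (sampleSwap σ q).2 → R q.1 σ ∨ R q.2 σ := by
      rintro ⟨t, ht⟩
      have e : ∑ i, f t ((sampleSwap σ q).1 i) - ∑ i, f t ((sampleSwap σ q).2 i) =
          ∑ i, boolSign (σ i) * f t (q.1 i) - ∑ i, boolSign (σ i) * f t (q.2 i) := by
        rw [← Finset.sum_sub_distrib, ← Finset.sum_sub_distrib]
        refine Finset.sum_congr rfl fun i _ => ?_
        by_cases h : σ i
        · simp [sampleSwap, boolSign, h]
        · simp [sampleSwap, boolSign, h]; ring
      rw [e] at ht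
      by_contra! hcon
      simp only [hR, not_exists, not_lt] at hcon
      have h2 := hcon.1 t
      have h3 := hcon.2 t
      have := abs_sub (∑ i, boolSign (σ i) * f t (q.1 i)) (∑ i, boolSign (σ i) * f t (q.2 i))
      linarith
    by_cases hH : Hd (sampleSwap σ q).1 (sampleSwap σ q).2
    · rcases himp hH with h | h
      · simp only [hH, h, if_true]; split_ifs <;> norm_num
      · simp only [hH, h, if_true]; split_ifs <;> norm_num
    · simp only [hH, if_false]; split_ifs <;> norm_num
  have hmarg : ∀ σ : Fin N → Bool,
      ∑ s, ∑ s', w s * w s' * ((if R s σ then (1 : ℝ) else 0) + if R s' σ then 1 else 0) =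
      2 * ∑ s, w s * if R s σ then 1 else 0 := by
    intro σ
    have e1 : ∑ s, ∑ s', w s * w s' * (if R s σ then (1 : ℝ) else 0) =
        ∑ s, w s * if R s σ then 1 else 0 := by
      refine Finset.sum_congr rfl fun s _ => ?_
      rw [← Finset.sum_mul, ← Finset.mul_sum, hw1, mul_one]
    have e2 : ∑ s, ∑ s', w s * w s' * (if R s' σ then (1 : ℝ) else 0) =
        ∑ s, w s * if R s σ then 1 else 0 := by
      simp only [mul_assoc, ← Finset.mul_sum]
      rw [← Finset.sum_mul, hw1, one_mul]
    simp only [mul_add, Finset.sum_add_distrib]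
    rw [e1, e2]; ring
  have hsum : (2 : ℝ) ^ N * ∑ s, ∑ s', w s * w s' * (if Hd s s' then (1 : ℝ) else 0) ≤
      2 ^ N * (2 * η) := by
    calc _ = ∑ _σ : Fin N → Bool, ∑ s, ∑ s', w s * w s' * (if Hd s s' then (1 : ℝ) else 0) := by
          simp
      _ ≤ ∑ σ : Fin N → Bool, 2 * ∑ s, w s * if R s σ then (1 : ℝ) else 0 :=
          Finset.sum_le_sum fun σ _ => (hswap σ).trans (hmarg σ).le
      _ = 2 * ∑ s, w s * ((Finset.univ.filter fun σ => R s σ).card : ℝ) := by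
          rw [← Finset.mul_sum, Finset.sum_comm]
          congr 1
          refine Finset.sum_congr rfl fun s _ => ?_
          rw [← Finset.mul_sum, Finset.sum_boole]
      _ ≤ 2 * ∑ s, w s * (2 ^ N * η) := by
          gcongr with s
          · exact hw0 s
          · exact hrad s
      _ = _ := by rw [← Finset.sum_mul, hw1]; ring
  have := le_of_mul_le_mul_left hsum (by positivity)
  linarith

theorem bestResp_nonempty {n m : ℕ} (hn : 1 ≤ n) (θ : AgentType n m) (t : Fin m → ℝ) :
    (BestResp θ t).Nonempty := by
  have : Nonempty (Fin n) := ⟨⟨0, hn⟩⟩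
  obtain ⟨i, hi⟩ := Finite.exists_max (uA θ t)
  exact ⟨i, hi⟩

theorem exists_uP_eq {n m : ℕ} (hn : 1 ≤ n) (r : Fin m → ℝ) (θ : AgentType n m)
    (t : Fin m → ℝ) : ∃ i ∈ BestResp θ t, uP r θ t = uPa r θ t i := by
  obtain ⟨i, hi, h⟩ := ((bestResp_nonempty hn θ t).image (uPa r θ t)).csSup_mem (Set.toFinite _)
  exact ⟨i, hi, h.symm⟩

theorem uPa_le_uP {n m : ℕ} (r : Fin m → ℝ) (θ : AgentType n m) (t : Fin m → ℝ) {i : Fin n}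
    (hi : i ∈ BestResp θ t) : uPa r θ t i ≤ uP r θ t :=
  le_csSup (Set.toFinite _).bddAbove ⟨i, hi, rfl⟩

theorem abs_uP_le_one {n m : ℕ} (hn : 1 ≤ n) {r : Fin m → ℝ} (hr0 : ∀ j, 0 ≤ r j)
    (hr1 : ∀ j, r j ≤ 1) (θ : AgentType n m) {t : Fin m → ℝ} (ht : t ∈ Cbounded m) :
    |uP r θ t| ≤ 1 := by
  obtain ⟨i, -, h⟩ := exists_uP_eq hn r θ t
  rw [h, uPa, ← θ.f_sum i]
  refine (Finset.abs_sum_le_sum_abs _ _).trans (Finset.sum_le_sum fun j _ => ?_)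
  rw [abs_mul, abs_of_nonneg (θ.f_nonneg i j)]
  refine mul_le_of_le_one_right (θ.f_nonneg i j) (abs_le.2 ⟨?_, ?_⟩)
  · linarith [hr0 j, (ht j).2]
  · linarith [hr1 j, (ht j).1]

theorem uPa_le_add {n m : ℕ} (r : Fin m → ℝ) (θ : AgentType n m) {t t' : Fin m → ℝ} {γ : ℝ}
    (h : ∀ j, |t j - t' j| ≤ γ) (i : Fin n) : uPa r θ t i ≤ uPa r θ t' i + γ := by
  have e : γ = ∑ j, θ.f i j * γ := by rw [← Finset.sum_mul, θ.f_sum, one_mul]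
  rw [e, uPa, uPa, ← Finset.sum_add_distrib]
  refine Finset.sum_le_sum fun j _ => ?_
  rw [← mul_add]
  refine mul_le_mul_of_nonneg_left ?_ (θ.f_nonneg i j)
  linarith [(abs_le.1 (h j)).1]

/-- Between contracts inducing the same best responses, the principal's utility is `1`-Lipschitz
in the sup norm. -/
theorem abs_uP_sub_le {n m : ℕ} (hn : 1 ≤ n) (r : Fin m → ℝ) (θ : AgentType n m)
    {t t' : Fin m → ℝ} {γ : ℝ} (h : ∀ j, |t j - t' j| ≤ γ) (hBR : BestResp θ t = BestResp θ t') :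
    |uP r θ t - uP r θ t'| ≤ γ := by
  have key : ∀ {t t' : Fin m → ℝ}, (∀ j, |t j - t' j| ≤ γ) → BestResp θ t = BestResp θ t' →
      uP r θ t ≤ uP r θ t' + γ := by
    intro t t' h hBR
    obtain ⟨i, hi, e⟩ := exists_uP_eq hn r θ t
    have h1 := uPa_le_add r θ h i
    have h2 := uPa_le_uP r θ t' (hBR ▸ hi)
    linarith
  have h1 := key h hBR
  have h2 := key (fun j => by rw [abs_sub_comm]; exact h j) hBR.symm
  exact abs_le.2 ⟨by linarith, by linarith⟩

theorem ncard_range_bestResp_le {n m k : ℕ} (x : Fin k → AgentType n m) :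
    (Set.range fun (t : Fin m → ℝ) j => BestResp (x j) t).ncard ≤
      (2 * (k * (n * n)) + 1) ^ (m + 1) := by
  let e : Fin (k * (n * n)) ≃ Fin k × Fin n × Fin n :=
    (Fintype.equivFinOfCardEq (by simp)).symm
  let φ : Fin (k * (n * n)) → ((Fin m → ℝ) × ℝ) →ₗ[ℝ] ℝ := fun a =>
    { toFun := fun v => ∑ j, ((x (e a).1).f (e a).2.1 j - (x (e a).1).f (e a).2.2 j) * v.1 j -
        ((x (e a).1).c (e a).2.1 - (x (e a).1).c (e a).2.2) * v.2
      map_add' := fun v w => by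
        simp only [Prod.fst_add, Prod.snd_add, Pi.add_apply, mul_add, Finset.sum_add_distrib]
        ring
      map_smul' := fun c v => by
        simp only [Prod.smul_fst, Prod.smul_snd, Pi.smul_apply, smul_eq_mul, RingHom.id_apply,
          mul_sub, Finset.mul_sum]
        congr 1
        · exact Finset.sum_congr rfl fun j _ => by ring
        · ring }
  have hφ : ∀ (t : Fin m → ℝ) j i i', φ (e.symm (j, i, i')) (t, 1) =
      uA (x j) t i - uA (x j) t i' := by
    intro t j i i'
    simp only [φ, LinearMap.coe_mk, AddHom.coe_mk, Equiv.apply_symm_apply, uA, sub_mul,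
      Finset.sum_sub_distrib, mul_one]
    ring
  have hsub : (Set.range fun (t : Fin m → ℝ) j => BestResp (x j) t) ⊆
      (fun (s : Fin (k * (n * n)) → SignType) j => {i | ∀ i', s (e.symm (j, i', i)) ≠ 1}) ''
        Set.range fun v a => SignType.sign (φ a v) := by
    rintro _ ⟨t, rfl⟩
    refine ⟨_, ⟨(t, 1), rfl⟩, ?_⟩
    funext j
    ext i
    simp only [hφ, BestResp, Set.mem_ofPred_eq, ne_eq, sign_eq_one_iff, sub_pos, not_lt]
  calc _ ≤ _ := Set.ncard_le_ncard hsub (Set.toFinite _)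
    _ ≤ _ := Set.ncard_image_le (Set.toFinite _)
    _ ≤ _ := ncard_range_sign_le _ (m + 1) _ (by simp) φ

open Classical in
/-- Best-response profiles pairwise differing on more than a `1 / 16 ^ (k + 1)` fraction of the sample
are few. -/
theorem card_bestResp_packing_le {n m N : ℕ} (hn : 1 ≤ n) (hm : 2 ≤ m) (hN : 0 < N)
    (x : Fin N → AgentType n m) (k : ℕ) (P : Finset (Fin N → Set (Fin n)))
    (hP : ∀ p ∈ P, ∃ t : Fin m → ℝ, (fun i => BestResp (x i) t) = p)
    (hsep : ∀ p ∈ P, ∀ q ∈ P, p ≠ q → 1 / 16 ^ (k + 1) * (N : ℝ) < hammingDist p q) :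
    P.card ≤ (16 ^ (k + 1) * (m * n)) ^ (10 * m) := by
  set X := 16 ^ (k + 1) * (m * n) with hX
  by_contra! hcon
  obtain ⟨P', hP'P, hP'card⟩ := Finset.exists_subset_card_eq hcon.le
  have h16 : 16 ≤ 16 ^ (k + 1) := by
    rw [pow_succ]; have := Nat.one_le_pow k 16 (by norm_num); omega
  have hmn : m ≤ m * n := Nat.le_mul_of_pos_right m hn
  have hX32 : 32 ≤ X := by
    calc 32 = 16 * 2 := rfl
      _ ≤ X := Nat.mul_le_mul h16 (hm.trans hmn)
  have hXR : (0 : ℝ) < X := by exact_mod_cast (by omega : 0 < X)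
  set κ := 20 * m * X * 16 ^ (k + 1) with hκ
  obtain ⟨y, hy⟩ := exists_injOn_comp hN κ P' (1 / 16 ^ (k + 1))
    (fun p hp q hq => hsep p (hP'P hp) q (hP'P hq)) (by
      rw [hP'card]
      have hβ1 : (1 : ℝ) / 16 ^ (k + 1) ≤ 1 := by
        rw [div_le_one (by positivity)]; exact one_le_pow₀ (by norm_num)
      have h1 : (1 - (1 : ℝ) / 16 ^ (k + 1)) ^ κ ≤ Real.exp (-(20 * m * X)) := by
        have e : Real.exp (-(20 * m * X : ℝ)) = Real.exp (-(1 / 16 ^ (k + 1))) ^ κ := by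
          rw [← Real.exp_nat_mul, hκ]
          congr 1
          push_cast
          field_simp
        rw [e]
        exact pow_le_pow_left₀ (by linarith) (Real.one_sub_le_exp_neg _) κ
      have h2 : (((X ^ (10 * m) : ℕ) : ℝ)) ^ 2 < Real.exp (20 * m * X) := by
        have hlog : Real.log X < X := by
          have := Real.log_le_sub_one_of_pos hXR; linarith
        have e : (((X ^ (10 * m) : ℕ) : ℝ)) ^ 2 = Real.exp (20 * m * Real.log X) := by
          rw [mul_comm (20 * (m : ℝ)), Real.exp_mul, Real.exp_log hXR]
          push_cast
          rw [← pow_mul, ← Real.rpow_natCast]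
          congr 1
          push_cast
          ring
        rw [e]
        have : (0 : ℝ) < m := by exact_mod_cast (by omega : 0 < m)
        gcongr
      calc _ ≤ (((X ^ (10 * m) : ℕ) : ℝ)) ^ 2 * Real.exp (-(20 * m * X)) := by gcongr
        _ < Real.exp (20 * m * X) * Real.exp (-(20 * m * X)) := by gcongr
        _ = 1 := by rw [← Real.exp_add]; simp)
  have hcount : P'.card ≤ (2 * (κ * (n * n)) + 1) ^ (m + 1) := by
    refine le_trans ?_ (ncard_range_bestResp_le fun j => x (y j))
    rw [← Finset.card_image_of_injOn hy, ← Set.ncard_coe_finset]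
    refine Set.ncard_le_ncard ?_ (Set.toFinite _)
    intro v hv
    obtain ⟨p, hp, rfl⟩ := Finset.mem_image.1 (Finset.mem_coe.1 hv)
    obtain ⟨t, rfl⟩ := hP p (hP'P hp)
    exact ⟨t, rfl⟩
  have hbase : 2 * (κ * (n * n)) + 1 ≤ X ^ 5 := by
    have hnX : n ≤ X := by
      calc n = 1 * (1 * n) := by ring
        _ ≤ X := Nat.mul_le_mul (by omega) (Nat.mul_le_mul_right _ (by omega))
    have e : κ * (n * n) = 20 * X * X * n := by rw [hκ, hX]; ring
    rw [e]
    have h3 : 20 * X * X * n ≤ 20 * X * X * X := Nat.mul_le_mul_left _ hnX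
    have h4 : 1 ≤ X ^ 3 := Nat.one_le_pow _ _ (by omega)
    calc _ ≤ 2 * (20 * X * X * X) + 1 := by omega
      _ ≤ 41 * X ^ 3 := by linarith [(by ring : X * X * X = X ^ 3)]
      _ ≤ X ^ 2 * X ^ 3 := by gcongr; nlinarith
      _ = X ^ 5 := by ring
  have hlt : (2 * (κ * (n * n)) + 1) ^ (m + 1) < X ^ (10 * m) := by
    calc _ ≤ (X ^ 5) ^ (m + 1) := Nat.pow_le_pow_left hbase _
      _ = X ^ (5 * (m + 1)) := by rw [← pow_mul]
      _ < X ^ (10 * m) := Nat.pow_lt_pow_right (by omega) (by omega)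
  omega

theorem card_label_le_exp {n m : ℕ} (hn : 1 ≤ n) (hm : 2 ≤ m) (k : ℕ) :
    (((16 ^ (k + 1) * (m * n)) ^ (10 * m) * (2 * 4 ^ k + 1) ^ m : ℕ) : ℝ) ≤
      Real.exp (40 * (m * Real.logb 2 (m * n)) * (k + 1)) := by
  have hmR : (2 : ℝ) ≤ m := by exact_mod_cast hm
  have hnR : (1 : ℝ) ≤ n := by exact_mod_cast hn
  have hmn : (2 : ℝ) ≤ m * n := by nlinarith
  set ℓ := Real.log 2 with hℓ
  have hℓ0 : 0 < ℓ := Real.log_pos (by norm_num)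
  have hℓ1 : ℓ < 0.6931471808 := Real.log_two_lt_d9
  set Λ := Real.logb 2 (m * n) with hΛ
  have hΛ1 : 1 ≤ Λ := by
    rw [hΛ, Real.le_logb_iff_rpow_le (by norm_num) (by positivity)]; simpa using hmn
  have hlogmn : Real.log (m * n) = ℓ * Λ := by
    rw [hΛ, Real.logb, ← hℓ]; field_simp
  have h1 : (((16 ^ (k + 1) * (m * n)) ^ (10 * m) * (2 * 4 ^ k + 1) ^ m : ℕ) : ℝ) ≤
      ((16 : ℝ) ^ (k + 1) * (m * n)) ^ (10 * m) * ((4 : ℝ) ^ (k + 1)) ^ m := by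
    push_cast
    gcongr
    have : (1 : ℝ) ≤ 4 ^ k := one_le_pow₀ (by norm_num)
    rw [pow_succ]; linarith
  refine h1.trans ?_
  rw [← Real.log_le_iff_le_exp (by positivity), Real.log_mul (by positivity) (by positivity),
    Real.log_pow, Real.log_pow, Real.log_mul (by positivity) (by positivity), Real.log_pow,
    Real.log_pow, hlogmn]
  have e16 : Real.log 16 = 4 * ℓ := by
    rw [show (16 : ℝ) = 2 ^ 4 by norm_num, Real.log_pow, ← hℓ]; norm_num
  have e4 : Real.log 4 = 2 * ℓ := by
    rw [show (4 : ℝ) = 2 ^ 2 by norm_num, Real.log_pow, ← hℓ]; norm_num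
  rw [e16, e4]
  push_cast
  have hk : (0 : ℝ) ≤ k := Nat.cast_nonneg k
  have h2 : ((k : ℝ) + 1) ≤ (k + 1) * Λ := by nlinarith
  have h3 : Λ ≤ (k + 1) * Λ := by nlinarith
  have h4 : 0 ≤ m * ((k + 1) * Λ) := by positivity
  calc _ = m * ℓ * (42 * (k + 1) + 10 * Λ) := by ring
    _ ≤ m * ℓ * (52 * ((k + 1) * Λ)) := by gcongr; linarith
    _ = (52 * ℓ) * (m * ((k + 1) * Λ)) := by ring
    _ ≤ 40 * (m * ((k + 1) * Λ)) := by gcongr; linarith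
    _ = _ := by ring

/-- On every sample, the bounded contracts split into few cells of small empirical `L²` diameter. -/
theorem exists_contract_label {n m N : ℕ} (hn : 1 ≤ n) (hm : 2 ≤ m) (hN : 0 < N)
    {r : Fin m → ℝ} (hr0 : ∀ j, 0 ≤ r j) (hr1 : ∀ j, r j ≤ 1)
    (x : Fin N → AgentType n m) (k : ℕ) :
    ∃ M : ℕ, (M : ℝ) ≤ Real.exp (40 * (m * Real.logb 2 (m * n)) * (k + 1)) ∧
      ∃ label : Cbounded m → Fin M, ∀ t t', label t = label t' →
        ∑ i, (uP r (x i) t - uP r (x i) t') ^ 2 ≤ (N : ℝ) / 16 ^ k := by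
  classical
  let prof : Cbounded m → Fin N → Set (Fin n) := fun t i => BestResp (x i) t
  let Q : Finset (Fin N → Set (Fin n)) := (Set.toFinite (Set.range prof)).toFinset
  have hQ : ∀ p, p ∈ Q ↔ ∃ t, prof t = p := by simp [Q]
  obtain ⟨P, -, hPcard, hnet⟩ := exists_hamming_net Q (1 / 16 ^ (k + 1)) (by positivity)
    ((16 ^ (k + 1) * (m * n)) ^ (10 * m)) (fun P hPQ hsep =>
      card_bestResp_packing_le hn hm hN x k P
        (fun p hp => by
          obtain ⟨t, ht⟩ := (hQ p).1 (hPQ hp)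
          exact ⟨t, ht⟩) hsep)
  have hnet' : ∀ t, ∃ p : P, (hammingDist (prof t) p : ℝ) ≤ 1 / 16 ^ (k + 1) * N := fun t => by
    obtain ⟨p, hp, h⟩ := hnet (prof t) ((hQ _).2 ⟨t, rfl⟩)
    exact ⟨⟨p, hp⟩, h⟩
  choose c hc using hnet'
  set q := 2 * 4 ^ k with hq
  have hq0 : (0 : ℝ) < q := by rw [hq]; push_cast; positivity
  let grid : Cbounded m → Fin m → Fin (q + 1) := fun t j =>
    ⟨⌊t.1 j * q⌋₊, Nat.lt_succ_of_le (Nat.floor_le_of_le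
      (mul_le_of_le_one_left hq0.le (t.2 j).2))⟩
  let e := Fintype.equivFin (P × (Fin m → Fin (q + 1)))
  refine ⟨Fintype.card (P × (Fin m → Fin (q + 1))), ?_, fun t => e (c t, grid t), ?_⟩
  · refine le_trans ?_ (card_label_le_exp hn hm k)
    rw [Nat.cast_le]
    simp only [Fintype.card_prod, Fintype.card_coe, Fintype.card_pi, Fintype.card_fin,
      Finset.prod_const, Finset.card_univ]
    gcongr
  · intro t t' h
    obtain ⟨h1, h2⟩ := Prod.mk.inj (e.injective h)
    have hgrid : ∀ j, |t.1 j - t'.1 j| ≤ 1 / q := by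
      intro j
      have h3 : ⌊t.1 j * q⌋₊ = ⌊t'.1 j * q⌋₊ := congrArg Fin.val (congrFun h2 j)
      have a1 := Nat.floor_le (mul_nonneg (t.2 j).1 hq0.le)
      have a2 := Nat.lt_floor_add_one (t.1 j * q)
      have b1 := Nat.floor_le (mul_nonneg (t'.2 j).1 hq0.le)
      have b2 := Nat.lt_floor_add_one (t'.1 j * q)
      rw [h3] at a1 a2
      have e : |t.1 j - t'.1 j| * q = |t.1 j * q - t'.1 j * q| := by
        rw [← sub_mul, abs_mul, abs_of_pos hq0]
      rw [le_div_iff₀ hq0, e]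
      exact abs_le.2 ⟨by linarith, by linarith⟩
    have hham : (hammingDist (prof t) (prof t') : ℝ) ≤ 2 * (1 / 16 ^ (k + 1) * N) := by
      have h3 := hammingDist_triangle (prof t) (c t) (prof t')
      have h4 := hc t
      have h5 := hc t'
      rw [← h1, hammingDist_comm] at h5
      have h6 : (hammingDist (prof t) (prof t') : ℝ) ≤
          hammingDist (prof t) (c t) + hammingDist (c t : Fin N → Set (Fin n)) (prof t') := by
        exact_mod_cast h3
      linarith
    have hpt : ∀ i, (uP r (x i) t - uP r (x i) t') ^ 2 ≤
        (1 / q) ^ 2 + 4 * if prof t i ≠ prof t' i then 1 else 0 := by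
      intro i
      rw [← sq_abs]
      split_ifs with hne
      · have h3 := abs_sub (uP r (x i) t) (uP r (x i) t')
        have h4 := abs_uP_le_one hn hr0 hr1 (x i) t.2
        have h5 := abs_uP_le_one hn hr0 hr1 (x i) t'.2
        have h6 : |uP r (x i) t - uP r (x i) t'| ^ 2 ≤ 2 ^ 2 :=
          pow_le_pow_left₀ (abs_nonneg _) (by linarith) 2
        have : 0 ≤ (1 / (q : ℝ)) ^ 2 := by positivity
        linarith
      · have := abs_uP_sub_le hn r (x i) hgrid (not_not.1 hne)
        have h6 := pow_le_pow_left₀ (abs_nonneg _) this 2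
        linarith
    have hsum : ∑ i, (4 * if prof t i ≠ prof t' i then (1 : ℝ) else 0) =
        4 * hammingDist (prof t) (prof t') := by
      rw [← Finset.mul_sum, Finset.sum_boole]; rfl
    calc _ ≤ ∑ i, ((1 / (q : ℝ)) ^ 2 + 4 * if prof t i ≠ prof t' i then 1 else 0) :=
          Finset.sum_le_sum fun i _ => hpt i
      _ = N * (1 / (q : ℝ)) ^ 2 + 4 * hammingDist (prof t) (prof t') := by
          rw [Finset.sum_add_distrib, hsum]; simp
      _ ≤ N * (1 / (q : ℝ)) ^ 2 + 4 * (2 * (1 / 16 ^ (k + 1) * N)) := by gcongr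
      _ = (N : ℝ) / 16 ^ k * (3 / 4) := by
          have e16 : (16 : ℝ) ^ k = 4 ^ k * 4 ^ k := by rw [← mul_pow]; norm_num
          rw [hq, pow_succ (16 : ℝ) k, e16]
          push_cast
          field_simp
          norm_num
      _ ≤ _ := mul_le_of_le_one_right (by positivity) (by norm_num)

theorem sum_chaining_tail_le {L δ y : ℝ} (hL : 2 ≤ L) (hδ0 : 0 < δ) (hδ1 : δ < 1)
    (hy : 100 * (L + Real.log (1 / δ)) ≤ y) (K : ℕ) :
    ∑ k ∈ Finset.range K, Real.exp (2 * (40 * L) * (k + 1)) * (2 * Real.exp (-(y * 4 ^ k))) ≤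
      δ / 4 := by
  have hlog : 0 ≤ Real.log (1 / δ) := Real.log_nonneg (by rw [le_div_iff₀ hδ0]; linarith)
  have he1 : Real.exp (-1) ≤ 1 / 2 := by
    have := Real.exp_one_gt_d9
    rw [Real.exp_neg, one_div]
    exact inv_anti₀ (by norm_num) (by linarith)
  have hterm : ∀ k : ℕ, Real.exp (2 * (40 * L) * (k + 1)) * (2 * Real.exp (-(y * 4 ^ k))) ≤
      δ / 8 * (1 / 2) ^ k := by
    intro k
    have h4 : ((k : ℝ) + 1) ≤ 4 ^ k := by
      have := one_add_mul_le_pow (a := (3 : ℝ)) (by norm_num) k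
      norm_num at this
      have hk : (0 : ℝ) ≤ k := Nat.cast_nonneg k
      linarith
    have hk : (0 : ℝ) ≤ k := Nat.cast_nonneg k
    have hy' : 100 * (L + Real.log (1 / δ)) * (k + 1) ≤ y * 4 ^ k := by
      gcongr
      linarith
    have hδe : δ = Real.exp (-Real.log (1 / δ)) := by
      rw [one_div, Real.log_inv, neg_neg, Real.exp_log hδ0]
    calc _ = 2 * Real.exp (2 * (40 * L) * (k + 1) + -(y * 4 ^ k)) := by rw [Real.exp_add]; ring
      _ ≤ 2 * Real.exp (-Real.log (1 / δ) + ((4 + k : ℕ) : ℝ) * (-1)) := by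
          refine mul_le_mul_of_nonneg_left (Real.exp_le_exp.2 ?_) zero_le_two
          push_cast
          nlinarith [mul_nonneg hlog hk, mul_nonneg hk (by linarith : 0 ≤ L - 2)]
      _ = 2 * (δ * Real.exp (-1) ^ (4 + k)) := by
          rw [Real.exp_add, ← hδe, Real.exp_nat_mul]
      _ ≤ 2 * (δ * (1 / 2) ^ (4 + k)) := by gcongr
      _ = _ := by rw [pow_add]; ring
  calc _ ≤ ∑ k ∈ Finset.range K, δ / 8 * (1 / 2) ^ k := Finset.sum_le_sum fun k _ => hterm k
    _ = δ / 8 * ∑ k ∈ Finset.range K, (1 / 2 : ℝ) ^ k := by rw [Finset.mul_sum]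
    _ ≤ δ / 8 * 2 := by gcongr; exact sum_geometric_two_le K
    _ = _ := by ring

/-- The support of a finitely supported distribution, as a finite type. -/
noncomputable instance FinDist.fintypeSupport {α : Type*} (D : FinDist α) :
    Fintype (Function.support D.p) := D.finite_support.fintype

theorem expect_eq_sum {α : Type*} (D : FinDist α) (g : α → ℝ) :
    expect D g = ∑ ω : Function.support D.p, D.p ω * g ω := by
  rw [expect, finsum_eq_sum_of_support_subset (s := (Function.support D.p).toFinset),
    ← Finset.sum_coe_sort]
  · exact Fintype.sum_equiv (Equiv.subtypeEquivRight (by simp)) _ _ (fun _ => rfl)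
  · intro a ha
    simp only [Set.coe_toFinset]
    exact left_ne_zero_of_mul ha

theorem prodProb_eq_iidProb {α : Type*} (D : FinDist α) (N : ℕ) (E : Set (Fin N → α)) :
    prodProb D N E =
      iidProb (fun ω : Function.support D.p => D.p ω) N (fun s => (fun i => (s i : α)) ∈ E) := by
  classical
  let ι : (Fin N → Function.support D.p) → Fin N → α := fun s i => s i
  have hinj : Function.Injective ι := fun s s' h =>
    funext fun i => Subtype.ext (congrFun h i)
  rw [prodProb, iidProb, finsum_mem_def,
    finsum_eq_sum_of_support_subset (s := Finset.univ.image ι), Finset.sum_image hinj.injOn]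
  · refine Finset.sum_congr rfl fun s _ => ?_
    by_cases h : (fun i => (s i : α)) ∈ E
    · simp [Set.indicator, ι, h]
    · simp [Set.indicator, ι, h]
  · intro s hs
    have h1 : ∏ i, D.p (s i) ≠ 0 := fun h => hs (by simp [Set.indicator, h])
    have h2 : ∀ i, D.p (s i) ≠ 0 := fun i => Finset.prod_ne_zero_iff.1 h1 i (Finset.mem_univ i)
    simp only [Finset.coe_image, Finset.coe_univ, Set.image_univ]
    exact ⟨fun i => ⟨s i, h2 i⟩, rfl⟩

/-- Uniform estimates with error `ε / 2` turn near-optimality on the sample into near-optimality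
on the distribution. -/
theorem expect_ge_of_uniform {n m N : ℕ} (hn : 1 ≤ n) (hN : 0 < N) {r : Fin m → ℝ}
    (hr0 : ∀ j, 0 ≤ r j) (hr1 : ∀ j, r j ≤ 1) (D : FinDist (AgentType n m))
    (s : Fin N → AgentType n m) {ε ρ : ℝ}
    (hunif : ∀ t ∈ Cbounded m,
      |∑ i, uP r (s i) t - N * expect D (fun θ => uP r θ t)| ≤ ε / 2 * N)
    {t : Fin m → ℝ} (ht : t ∈ Cbounded m)
    (hopt : (1 / (N : ℝ)) * ∑ i, uP r (s i) t ≥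
      sSup ((fun t' => (1 / (N : ℝ)) * ∑ i, uP r (s i) t') '' Cbounded m) - ρ) :
    expect D (fun θ => uP r θ t) ≥ OPT (Cbounded m) r D - ε - ρ := by
  have hNR : (0 : ℝ) < N := by exact_mod_cast hN
  have hunif' : ∀ t ∈ Cbounded m,
      |(1 / (N : ℝ)) * ∑ i, uP r (s i) t - expect D (fun θ => uP r θ t)| ≤ ε / 2 := by
    intro t ht
    have h := hunif t ht
    have e : (1 / (N : ℝ)) * ∑ i, uP r (s i) t - expect D (fun θ => uP r θ t) =
        (∑ i, uP r (s i) t - N * expect D (fun θ => uP r θ t)) / N := by field_simp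
    rw [e, abs_div, abs_of_pos hNR, div_le_iff₀ hNR]
    exact h
  have hbdd : BddAbove ((fun t' => (1 / (N : ℝ)) * ∑ i, uP r (s i) t') '' Cbounded m) := by
    refine ⟨1, ?_⟩
    rintro _ ⟨t', ht', rfl⟩
    have h1 : ∑ i, uP r (s i) t' ≤ ∑ _i : Fin N, (1 : ℝ) :=
      Finset.sum_le_sum fun i _ => (abs_le.1 (abs_uP_le_one hn hr0 hr1 (s i) ht')).2
    simp only [Finset.sum_const, Finset.card_univ, Fintype.card_fin, nsmul_eq_mul, mul_one] at h1
    simp only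
    rw [one_div, inv_mul_le_iff₀ hNR]
    linarith
  have hOPT : OPT (Cbounded m) r D ≤ expect D (fun θ => uP r θ t) + ε + ρ := by
    refine csSup_le ⟨_, t, ht, rfl⟩ ?_
    rintro _ ⟨t', ht', rfl⟩
    have h1 := le_csSup hbdd ⟨t', ht', rfl⟩
    have h2 := (abs_le.1 (hunif' t' ht')).1
    have h3 := (abs_le.1 (hunif' t ht)).2
    simp only at h1 ⊢
    linarith
  linarith

/-- Sample complexity of learning bounded contracts. With rewards at most
`1`, there is an absolute constant `A > 0` such that if
`N ≥ A·(1/ε²)·(m·log₂(m·n) + log(1/δ))`, then for every finitely supported `D`, with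
probability at least `1 − δ` over an i.i.d. sample of size `N`, every
`ρ`-empirically-optimal bounded contract is `(ε + ρ)`-optimal for `C_bounded` on `D`. -/
theorem stmt_12 : ∃ A : ℝ, 0 < A ∧
    ∀ (n m : ℕ), 1 ≤ n → 2 ≤ m → ∀ r : Fin m → ℝ,
      (∀ j, 0 ≤ r j) → (∀ j : Fin m, (j : ℕ) = 0 → r j = 0) → (∀ j, r j ≤ 1) →
      ∀ ε δ ρ : ℝ, 0 < ε → ε < 1 → 0 < δ → δ < 1 → 0 ≤ ρ →
      ∀ N : ℕ, (N : ℝ) ≥ A * (1/ε^2) * ((m : ℝ) * Real.logb 2 ((m : ℝ) * n) + Real.log (1/δ)) →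
      ∀ D : FinDist (AgentType n m),
        prodProb D N {s | ∀ t ∈ Cbounded m,
            (1/(N:ℝ)) * ∑ i, uP r (s i) t ≥
              sSup ((fun t' => (1/(N:ℝ)) * ∑ i, uP r (s i) t') '' Cbounded m) - ρ →
            expect D (fun θ => uP r θ t) ≥ OPT (Cbounded m) r D - ε - ρ} ≥ 1 - δ := by
  refine ⟨13107200, by norm_num, ?_⟩
  intro n m hn hm r hr0 _ hr1 ε δ ρ hε0 hε1 hδ0 hδ1 _ N hN D
  set L := (m : ℝ) * Real.logb 2 ((m : ℝ) * n) with hLdef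
  have hmR : (2 : ℝ) ≤ m := by exact_mod_cast hm
  have hnR : (1 : ℝ) ≤ n := by exact_mod_cast hn
  have hL : 2 ≤ L := by
    have : 1 ≤ Real.logb 2 ((m : ℝ) * n) := by
      rw [Real.le_logb_iff_rpow_le (by norm_num) (by positivity), Real.rpow_one]
      nlinarith
    nlinarith
  have hlog : 0 ≤ Real.log (1 / δ) := Real.log_nonneg (by rw [le_div_iff₀ hδ0]; linarith)
  have hNε : 13107200 * (L + Real.log (1 / δ)) ≤ N * ε ^ 2 := by
    have h := mul_le_mul_of_nonneg_right hN (sq_nonneg ε)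
    refine le_trans (le_of_eq ?_) h
    field_simp
  have hN0 : 0 < N := by
    rcases Nat.eq_zero_or_pos N with h | h
    · rw [h, Nat.cast_zero, zero_mul] at hNε; linarith
    · exact h
  have h0 : ∀ ω : Function.support D.p, 0 ≤ D.p ω := fun ω => D.nonneg ω
  have h1 : ∑ ω : Function.support D.p, D.p ω = 1 := by
    have := expect_eq_sum D (fun _ => 1)
    simp only [expect, mul_one] at this
    rw [← this, D.total]
  have hbad := iidProb_exists_deviation_le (T := Cbounded m) (N := N) h0 h1
    (fun t ω => uP r ω.1 t) (fun t ω => abs_uP_le_one hn hr0 hr1 _ t.2)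
    (a := ε / 2) (η := δ / 4) (by linarith) (by linarith)
    (by
      have h2 : Real.exp (-2) ≤ 1 / 4 := by
        have h3 := Real.exp_one_gt_d9
        rw [show (-2 : ℝ) = -(1 + 1) by norm_num, Real.exp_neg, Real.exp_add, one_div]
        exact inv_anti₀ (by norm_num) (by nlinarith)
      refine le_trans (Real.exp_le_exp.2 ?_) h2
      linarith)
    (fun s => by
      refine card_rademacher_gt_le (fun (t : Cbounded m) i => uP r (s i).1 t)
        (fun t i => abs_uP_le_one hn hr0 hr1 _ t.2) (40 * L) (by linarith)
        (fun k => exists_contract_label hn hm hN0 hr0 hr1 (fun i => (s i).1) k) hN0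
        (ε / 2 / 4) (δ / 4) (by linarith) fun K => ?_
      have := sum_chaining_tail_le (y := N * (ε / 2 / 4) ^ 2 / 2048) hL hδ0 hδ1 (by linarith) K
      refine le_trans (le_of_eq (Finset.sum_congr rfl fun k _ => ?_)) this
      rw [mul_div_right_comm])
  have hgood := iidProb_add_iidProb_not (fun ω : Function.support D.p => D.p ω) h1 N
    (fun s => ∃ t : Cbounded m, ε / 2 * N < |∑ i, uP r (s i).1 t -
      N * ∑ ω : Function.support D.p, D.p ω * uP r ω.1 t|)
  rw [prodProb_eq_iidProb]
  refine ge_iff_le.2 (le_trans (b := iidProb (fun ω : Function.support D.p => D.p ω) N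
    (fun s => ¬ ∃ t : Cbounded m, ε / 2 * N < |∑ i, uP r (s i).1 t -
      N * ∑ ω : Function.support D.p, D.p ω * uP r ω.1 t|)) (by linarith)
    (iidProb_mono h0 fun s hs t ht hopt => ?_))
  refine expect_ge_of_uniform hn hN0 hr0 hr1 D (fun i => (s i).1) (fun t ht => ?_) ht hopt
  rw [expect_eq_sum]
  exact not_lt.1 fun h => hs ⟨⟨t, ht⟩, h⟩
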